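/- arXiv:1906.04071 — 2 statements merged into one kernel-verified Lean document; each statement's English description precedes it below -/
import Mathlib

section
/- For every c ∈ ℝ the iterated integrals of the shifted Legendre polynomials satisfy: ∫₀^c ∫₀^x P₀(t) dt dx = (ξ₀² − ξ₁²) P₀(c) + ξ₀ξ₁ P₁(c) + ξ₁ξ₂ P₂(c); ∫₀^c ∫₀^x P₁(t) dt dx = −ξ₀ξ₁ P₀(c) − (ξ₁² + ξ₂²) P₁(c) + ξ₂ξ₃ P₃(c); and for every integer j ≥ 2, ∫₀^c ∫₀^x P_j(t) dt dx = ξ_{j−1}ξ_j P_{j−2}(c) − (ξ_j² + ξ_{j+1}²) P_j(c) + ξ_{j+1}ξ_{j+2} P_{j+2}(c). -/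
open MeasureTheory intervalIntegral

section Legendre

open Polynomial

/-- The integral over `[0, 1]` as a linear functional on real polynomials. -/
noncomputable def unitIntegral : ℝ[X] →ₗ[ℝ] ℝ where
  toFun p := ∫ x in (0:ℝ)..1, p.eval x
  map_add' p q := by
    simp only [eval_add]
    exact integral_add (p.continuous.intervalIntegrable _ _) (q.continuous.intervalIntegrable _ _)
  map_smul' c p := by simp

theorem unitIntegral_mul_apply (p q : ℝ[X]) :
    unitIntegral (p * q) = ∫ x in (0:ℝ)..1, p.eval x * q.eval x := by
  simp [unitIntegral]

theorem integral_eval_derivative (p : ℝ[X]) (a b : ℝ) :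
    ∫ x in a..b, (derivative p).eval x = p.eval b - p.eval a :=
  integral_eq_sub_of_hasDerivAt (fun x _ => p.hasDerivAt x)
    ((derivative p).continuous.intervalIntegrable _ _)

theorem unitIntegral_derivative (p : ℝ[X]) :
    unitIntegral (derivative p) = p.eval 1 - p.eval 0 :=
  integral_eval_derivative p 0 1

theorem exists_derivative_eq_and_eval_zero (p : ℝ[X]) :
    ∃ q : ℝ[X], derivative q = p ∧ q.eval 0 = 0 := by
  induction p using Polynomial.induction_on' with
  | add p q hp hq =>
    obtain ⟨p', hp, hp0⟩ := hp
    obtain ⟨q', hq, hq0⟩ := hq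
    exact ⟨p' + q', by simp [hp, hq], by simp [hp0, hq0]⟩
  | monomial n a =>
    refine ⟨monomial (n + 1) (a / (n + 1)), ?_, by simp⟩
    rw [derivative_monomial]
    congr 1
    push_cast
    field_simp

theorem degree_lt_of_degree_derivative_lt {p : ℝ[X]} {n : ℕ} (h : (derivative p).degree < n) :
    p.degree < (n + 1 : ℕ) := by
  rw [degree_lt_iff_coeff_zero] at h ⊢
  rintro (_ | m) hm
  · omega
  · have := h m (by omega)
    rw [coeff_derivative] at this
    exact (mul_eq_zero.mp this).resolve_right (by positivity)

variable {P : ℕ → ℝ[X]} (hdeg : ∀ j, (P j).degree = j)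

include hdeg

theorem coeff_self_ne_zero_of_degree_eq (n : ℕ) : (P n).coeff n ≠ 0 :=
  coeff_ne_zero_of_eq_degree (hdeg n)

theorem exists_eq_sum_of_degree_lt (n : ℕ) (R : ℝ[X]) (hR : R.degree < n) :
    ∃ c : ℕ → ℝ, R = ∑ i ∈ Finset.range n, c i • P i := by
  induction n generalizing R with
  | zero => exact ⟨0, by simpa [Nat.cast_withBot] using hR⟩
  | succ n ih =>
    have hk := coeff_self_ne_zero_of_degree_eq hdeg n
    obtain ⟨c, hc⟩ := ih (R - (R.coeff n / (P n).coeff n) • P n) (by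
      rw [degree_lt_iff_coeff_zero] at hR ⊢
      intro m hm
      rcases hm.eq_or_lt with rfl | hm
      · simp [hk]
      · have : (P n).coeff m = 0 := coeff_eq_zero_of_degree_lt (by rw [hdeg]; exact_mod_cast hm)
        simp [this, hR m hm])
    refine ⟨Function.update c n (R.coeff n / (P n).coeff n), ?_⟩
    rw [Finset.sum_range_succ, Function.update_self, Finset.sum_congr rfl fun i hi => by
      rw [Function.update_of_ne (Finset.mem_range.mp hi).ne], ← hc]
    ring

variable (horth : ∀ i j, unitIntegral (P i * P j) = if i = j then 1 else 0)

include horth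

theorem unitIntegral_mul_eq_zero_of_degree_lt {n : ℕ} {R : ℝ[X]} (hR : R.degree < n) :
    unitIntegral (R * P n) = 0 := by
  obtain ⟨c, rfl⟩ := exists_eq_sum_of_degree_lt hdeg n R hR
  rw [Finset.sum_mul, map_sum]
  refine Finset.sum_eq_zero fun i hi => ?_
  simp [horth, (Finset.mem_range.mp hi).ne]

theorem eq_zero_of_forall_unitIntegral_eq_zero {n : ℕ} {R : ℝ[X]} (hR : R.degree < n)
    (h : ∀ i < n, unitIntegral (R * P i) = 0) : R = 0 := by
  obtain ⟨c, rfl⟩ := exists_eq_sum_of_degree_lt hdeg n R hR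
  refine Finset.sum_eq_zero fun i hi => ?_
  have := h i (Finset.mem_range.mp hi)
  rw [Finset.sum_mul, map_sum] at this
  simp only [smul_mul_assoc, map_smul, horth, smul_eq_mul, mul_ite, mul_one, mul_zero] at this
  rw [Finset.sum_ite_eq' _ i, if_pos hi] at this
  simp [this]

theorem eval_one_sq (n : ℕ) : (P n).eval 1 ^ 2 = 2 * n + 1 := by
  have h1 := unitIntegral_derivative (X * (P n * P n))
  have h2 : unitIntegral ((X * derivative (P n) - (n : ℝ) • P n) * P n) = 0 := by
    refine unitIntegral_mul_eq_zero_of_degree_lt hdeg horth ?_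
    rw [degree_lt_iff_coeff_zero]
    rintro (_ | m) hm
    · obtain rfl : n = 0 := by omega
      simp
    · rw [coeff_sub, coeff_X_mul, coeff_derivative, coeff_smul, smul_eq_mul]
      rcases hm.eq_or_lt with rfl | hm
      · push_cast
        ring
      · have : (P n).coeff (m + 1) = 0 :=
          coeff_eq_zero_of_degree_lt (by rw [hdeg]; exact_mod_cast hm)
        simp [this]
  rw [sub_mul, smul_mul_assoc, map_sub, map_smul, horth, if_pos rfl] at h2
  have h3 : derivative (X * (P n * P n))
      = P n * P n + (2 : ℝ) • (X * derivative (P n) * P n) := by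
    rw [smul_eq_C_mul]
    simp only [derivative_mul, derivative_X, map_ofNat]
    ring
  rw [h3, map_add, map_smul, horth, if_pos rfl] at h1
  simp only [smul_eq_mul, eval_mul, eval_X, zero_mul, sub_zero] at h1 h2
  linarith

variable (hpos : ∀ j, 0 < (P j).coeff j)

include hpos

theorem zeroth_eq_one : P 0 = 1 := by
  have h0 : P 0 = C ((P 0).coeff 0) := eq_C_of_degree_le_zero (by rw [hdeg]; rfl)
  have h1 := eval_one_sq hdeg horth 0
  have h2 := hpos 0
  rw [h0] at h1
  simp only [eval_C, Nat.cast_zero, mul_zero, zero_add] at h1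
  have : (P 0).coeff 0 = 1 := by nlinarith
  rw [h0, this, C_1]

variable {Q : ℕ → ℝ[X]} (hQ : ∀ j, derivative (Q j) = P j) (hQ0 : ∀ j, (Q j).eval 0 = 0)

include hQ

omit horth hpos in
theorem antiderivative_degree_lt (j : ℕ) : (Q j).degree < (j + 2 : ℕ) :=
  degree_lt_of_degree_derivative_lt (by rw [hQ, hdeg]; exact_mod_cast j.lt_succ_self)

theorem unitIntegral_antiderivative_mul_succ_pos (j : ℕ) :
    0 < unitIntegral (Q j * P (j + 1)) := by
  obtain ⟨c, hc⟩ := exists_eq_sum_of_degree_lt hdeg (j + 2) (Q j)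
    (antiderivative_degree_lt hdeg hQ j)
  rw [Finset.sum_range_succ] at hc
  have hlt : (∑ i ∈ Finset.range (j + 1), c i • P i).degree < (j + 1 : ℕ) := by
    rw [degree_lt_iff_coeff_zero]
    intro m hm
    rw [finsetSum_coeff]
    refine Finset.sum_eq_zero fun i hi => ?_
    rw [coeff_smul, coeff_eq_zero_of_degree_lt, smul_zero]
    rw [hdeg]
    exact_mod_cast (Finset.mem_range.mp hi).trans_le hm
  have hα : unitIntegral (Q j * P (j + 1)) = c (j + 1) := by
    rw [hc, add_mul, map_add, unitIntegral_mul_eq_zero_of_degree_lt hdeg horth hlt,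
      smul_mul_assoc, map_smul, horth]
    simp
  have hcoeff : (Q j).coeff (j + 1) = c (j + 1) * (P (j + 1)).coeff (j + 1) := by
    rw [hc, coeff_add, coeff_eq_zero_of_degree_lt hlt]
    simp
  have h := hpos j
  rw [← hQ j, coeff_derivative, hcoeff] at h
  rw [hα]
  have h1 := hpos (j + 1)
  exact pos_of_mul_pos_left (pos_of_mul_pos_left h (by positivity)) h1.le

include hQ0

theorem antiderivative_eval_one (j : ℕ) (hj : j ≠ 0) : (Q j).eval 1 = 0 := by
  have h := horth j 0
  rw [zeroth_eq_one hdeg horth hpos, mul_one, ← hQ j, unitIntegral_derivative, hQ0] at h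
  simpa [hj] using h

theorem unitIntegral_antiderivative_mul_swap (i j : ℕ) (hj : j ≠ 0) :
    unitIntegral (Q j * P i) = -unitIntegral (Q i * P j) := by
  have h := unitIntegral_derivative (Q i * Q j)
  simp only [derivative_mul, hQ, eval_mul, hQ0,
    antiderivative_eval_one hdeg horth hpos hQ hQ0 j hj, map_add] at h
  rw [mul_comm (P i)] at h
  linarith

theorem antiderivative_succ_eq (j : ℕ) :
    Q (j + 1) = unitIntegral (Q (j + 1) * P (j + 2)) • P (j + 2)
      - unitIntegral (Q j * P (j + 1)) • P j := by
  rw [← sub_eq_zero]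
  have hswap := unitIntegral_antiderivative_mul_swap hdeg horth hpos hQ hQ0
  refine eq_zero_of_forall_unitIntegral_eq_zero hdeg horth (n := j + 3) ?_ fun i hi => ?_
  · have h1 := antiderivative_degree_lt hdeg hQ (j + 1)
    rw [degree_lt_iff_coeff_zero] at h1 ⊢
    intro m hm
    have h2 : ∀ i < m, (P i).coeff m = 0 := fun i hi =>
      coeff_eq_zero_of_degree_lt (by rw [hdeg]; exact_mod_cast hi)
    simp [h1 m hm, h2 (j + 2) (by omega), h2 j (by omega)]
  · simp only [sub_mul, smul_mul_assoc, map_sub, map_smul, horth, smul_eq_mul]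
    obtain rfl | rfl | rfl | hi : i = j + 2 ∨ i = j + 1 ∨ i = j ∨ i < j := by omega
    · simp
    · have := hswap (j + 1) (j + 1) (by omega)
      rw [if_neg (show j + 2 ≠ j + 1 by omega), if_neg (show j ≠ j + 1 by omega)]
      linarith
    · simp [hswap i (i + 1) (by omega)]
    · rw [hswap i (j + 1) (by omega), unitIntegral_mul_eq_zero_of_degree_lt hdeg horth
        ((antiderivative_degree_lt hdeg hQ i).trans_le (by exact_mod_cast (by omega)))]
      simp [show j + 2 ≠ i by omega, show j ≠ i by omega]

theorem antiderivative_zero_eq :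
    Q 0 = (1 / 2 : ℝ) • P 0 + unitIntegral (Q 0 * P 1) • P 1 ∧
      unitIntegral (Q 0 * P 1) ^ 2 = 1 / 12 := by
  have hP0 := zeroth_eq_one hdeg horth hpos
  have hX : Q 0 = X := by
    have h1 : derivative (Q 0 - X) = 0 := by simp [hQ, hP0]
    have h2 := eq_C_of_derivative_eq_zero h1
    have h3 : (Q 0 - X).coeff 0 = 0 := by
      rw [coeff_zero_eq_eval_zero]
      simp [hQ0]
    rw [h3, C_0] at h2
    exact sub_eq_zero.mp h2
  have hhalf : unitIntegral X = 1 / 2 := by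
    simp [unitIntegral]
  have hthird : unitIntegral (X * X) = 1 / 3 := by
    simp [unitIntegral, ← pow_two, integral_pow]
    norm_num
  have heq : Q 0 = (1 / 2 : ℝ) • P 0 + unitIntegral (Q 0 * P 1) • P 1 := by
    rw [← sub_eq_zero]
    refine eq_zero_of_forall_unitIntegral_eq_zero hdeg horth (n := 2) ?_ fun i hi => ?_
    · have h1 := antiderivative_degree_lt hdeg hQ 0
      rw [degree_lt_iff_coeff_zero] at h1 ⊢
      intro m hm
      have h2 : ∀ i < m, (P i).coeff m = 0 := fun i hi =>
        coeff_eq_zero_of_degree_lt (by rw [hdeg]; exact_mod_cast hi)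
      simp [h1 m hm, h2 0 (by omega), h2 1 (by omega)]
    · simp only [sub_mul, add_mul, smul_mul_assoc, map_sub, map_add, map_smul, horth, smul_eq_mul]
      obtain rfl | rfl : i = 0 ∨ i = 1 := by omega
      · rw [hX, hP0, mul_one, hhalf]
        simp
      · simp
  refine ⟨heq, ?_⟩
  have hsq := congrArg (fun R => unitIntegral (R * Q 0)) heq
  simp only [add_mul, smul_mul_assoc, map_add, map_smul, smul_eq_mul] at hsq
  rw [mul_comm (P 1), hP0, one_mul, hX, hhalf, hthird] at hsq
  rw [hX]
  linarith

theorem unitIntegral_antiderivative_mul_succ_sq (j : ℕ) :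
    unitIntegral (Q j * P (j + 1)) ^ 2 = 1 / (4 * (4 * ((j + 1 : ℕ) : ℝ) ^ 2 - 1)) := by
  induction j with
  | zero =>
    rw [(antiderivative_zero_eq hdeg horth hpos hQ hQ0).2]
    norm_num
  | succ j ih =>
    have h := congrArg (eval 1) (antiderivative_succ_eq hdeg horth hpos hQ hQ0 j)
    rw [antiderivative_eval_one hdeg horth hpos hQ hQ0 (j + 1) (by omega)] at h
    simp only [eval_sub, eval_smul, smul_eq_mul] at h
    have h1 := eval_one_sq hdeg horth j
    have h2 := eval_one_sq hdeg horth (j + 2)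
    have h3 : unitIntegral (Q (j + 1) * P (j + 2)) ^ 2 * (2 * ((j + 2 : ℕ) : ℝ) + 1)
        = unitIntegral (Q j * P (j + 1)) ^ 2 * (2 * j + 1) := by
      rw [← h1, ← h2, ← mul_pow, ← mul_pow, sub_eq_zero.mp h.symm]
    rw [ih] at h3
    push_cast at h3 ⊢
    have e1 : (4 * ((j : ℝ) + 1) ^ 2 - 1) = (2 * j + 1) * (2 * j + 3) := by ring
    have e2 : (4 * ((j : ℝ) + 1 + 1) ^ 2 - 1) = (2 * j + 3) * (2 * j + 5) := by ring
    rw [e1] at h3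
    rw [e2]
    field_simp at h3 ⊢
    linarith

theorem unitIntegral_antiderivative_mul_succ (j : ℕ) :
    unitIntegral (Q j * P (j + 1))
      = 1 / (2 * Real.sqrt |4 * ((j + 1 : ℕ) : ℝ) ^ 2 - 1|) := by
  have hpos' : 0 < 4 * ((j + 1 : ℕ) : ℝ) ^ 2 - 1 := by
    push_cast
    nlinarith [(Nat.cast_nonneg j : (0 : ℝ) ≤ j)]
  rw [← sq_eq_sq₀ (unitIntegral_antiderivative_mul_succ_pos hdeg horth hpos hQ j).le
    (by positivity), unitIntegral_antiderivative_mul_succ_sq hdeg horth hpos hQ hQ0,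
    div_pow, mul_pow, abs_of_pos hpos', Real.sq_sqrt hpos'.le]
  norm_num

end Legendre

/-- Iterated integrals of the shifted Legendre polynomials:
`∫₀^c∫₀^x P₀ = (ξ₀²−ξ₁²)P₀(c) + ξ₀ξ₁P₁(c) + ξ₁ξ₂P₂(c)`,
`∫₀^c∫₀^x P₁ = −ξ₀ξ₁P₀(c) − (ξ₁²+ξ₂²)P₁(c) + ξ₂ξ₃P₃(c)`, and for `j ≥ 2`,
`∫₀^c∫₀^x P_j = ξ_{j−1}ξ_j P_{j−2}(c) − (ξ_j²+ξ_{j+1}²)P_j(c) + ξ_{j+1}ξ_{j+2}P_{j+2}(c)`. -/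
theorem stmt10 (P : ℕ → Polynomial ℝ)
    (hdeg : ∀ j, (P j).degree = j)
    (hlead : ∀ j, 0 < (P j).leadingCoeff)
    (horth : ∀ i j, (∫ x in (0:ℝ)..1, (P i).eval x * (P j).eval x)
      = if i = j then 1 else 0)
    (ξ : ℕ → ℝ)
    (hξ : ∀ i, ξ i = 1 / (2 * Real.sqrt |4 * (i : ℝ)^2 - 1|)) :
    (∀ c : ℝ, (∫ x in (0:ℝ)..c, ∫ t in (0:ℝ)..x, (P 0).eval t)
        = (ξ 0 ^ 2 - ξ 1 ^ 2) * (P 0).eval c + ξ 0 * ξ 1 * (P 1).eval c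
          + ξ 1 * ξ 2 * (P 2).eval c) ∧
    (∀ c : ℝ, (∫ x in (0:ℝ)..c, ∫ t in (0:ℝ)..x, (P 1).eval t)
        = -(ξ 0 * ξ 1) * (P 0).eval c - (ξ 1 ^ 2 + ξ 2 ^ 2) * (P 1).eval c
          + ξ 2 * ξ 3 * (P 3).eval c) ∧
    (∀ j : ℕ, 2 ≤ j → ∀ c : ℝ, (∫ x in (0:ℝ)..c, ∫ t in (0:ℝ)..x, (P j).eval t)
        = ξ (j-1) * ξ j * (P (j-2)).eval c - (ξ j ^ 2 + ξ (j+1) ^ 2) * (P j).eval c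
          + ξ (j+1) * ξ (j+2) * (P (j+2)).eval c) := by
  have horth' : ∀ i j, unitIntegral (P i * P j) = if i = j then 1 else 0 := fun i j => by
    rw [unitIntegral_mul_apply, horth]
  have hpos : ∀ j, 0 < (P j).coeff j := fun j => by
    have h := hlead j
    rwa [Polynomial.leadingCoeff, Polynomial.natDegree_eq_of_degree_eq_some (hdeg j)] at h
  choose Q hQ hQ0 using fun j => exists_derivative_eq_and_eval_zero (P j)
  have hprim : ∀ j x, ∫ t in (0:ℝ)..x, (P j).eval t = (Q j).eval x := fun j x => by
    rw [← hQ j, integral_eval_derivative, hQ0, sub_zero]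
  have hα : ∀ j, unitIntegral (Q j * P (j + 1)) = ξ (j + 1) := fun j => by
    rw [hξ, unitIntegral_antiderivative_mul_succ hdeg horth' hpos hQ hQ0]
  have hξ0 : ξ 0 = 1 / 2 := by simp [hξ]
  have hzero : ∀ x, (Q 0).eval x = ξ 0 * (P 0).eval x + ξ 1 * (P 1).eval x := fun x => by
    rw [(antiderivative_zero_eq hdeg horth' hpos hQ hQ0).1, hα 0, hξ0]
    simp
  have hsucc : ∀ j x, (Q (j + 1)).eval x
      = ξ (j + 2) * (P (j + 2)).eval x - ξ (j + 1) * (P j).eval x := fun j x => by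
    rw [antiderivative_succ_eq hdeg horth' hpos hQ hQ0 j, hα, hα]
    simp
  have hintegrable : ∀ (a : ℝ) (j : ℕ) (c : ℝ),
      IntervalIntegrable (fun x => a * (P j).eval x) volume 0 c := fun a j c =>
    (continuous_const.mul (P j).continuous).intervalIntegrable _ _
  simp only [hprim]
  have hiter : ∀ j c, ∫ x in (0:ℝ)..c, (Q (j + 1)).eval x
      = ξ (j + 2) * (Q (j + 2)).eval c - ξ (j + 1) * (Q j).eval c := fun j c => by
    simp only [hsucc j]
    rw [integral_sub (hintegrable _ _ _) (hintegrable _ _ _), intervalIntegral.integral_const_mul,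
      intervalIntegral.integral_const_mul, hprim, hprim]
  refine ⟨fun c => ?_, fun c => ?_, fun j hj c => ?_⟩
  · simp only [hzero]
    rw [integral_add (hintegrable _ _ _) (hintegrable _ _ _), intervalIntegral.integral_const_mul,
      intervalIntegral.integral_const_mul, hprim, hprim, hzero, hsucc 0]
    ring
  · rw [hiter 0, hsucc 1, hzero]
    ring
  · obtain ⟨k, rfl⟩ := Nat.exists_eq_add_of_le' hj
    rw [hiter (k + 1), hsucc (k + 2), hsucc k]
    simp only [Nat.add_sub_cancel, show k + 2 - 1 = k + 1 by omega]
    ring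
end

section
/- Let s ≥ 2 be an integer and define ā^{(s)}_{cτ} := Σ_{i=0}^{s−1} Σ_{j=0}^{s−1} (∫₀^c P_i(x) dx) (∫₀¹ P_i(ξ)(∫₀^ξ P_j(x) dx) dξ) P_j(τ). Then for every τ ∈ [0,1], ā^{(s)}_{1τ} = 1 − τ. -/
open MeasureTheory intervalIntegral Finset

/-- The iterated integral of a continuous function over `[0, 1]`, by integration by parts. -/
theorem integral_primitive_eq_integral_one_sub_mul {f : ℝ → ℝ} (hf : Continuous f) :
    (∫ ξ in (0:ℝ)..1, ∫ x in (0:ℝ)..ξ, f x) = ∫ x in (0:ℝ)..1, (1 - x) * f x := by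
  have hF : ∀ ξ : ℝ, HasDerivAt (fun ξ => ∫ x in (0:ℝ)..ξ, f x) (f ξ) ξ :=
    fun ξ => hf.integral_hasStrictDerivAt 0 ξ |>.hasDerivAt
  have h := integral_mul_deriv_eq_deriv_mul (a := (0:ℝ)) (b := 1)
    (fun x _ => (hasDerivAt_id x).const_sub 1) (fun x _ => hF x)
    (continuous_const.intervalIntegrable 0 1) (hf.intervalIntegrable 0 1)
  simpa using h.symm

theorem orthonormal_degree_zero_eq_one {p : Polynomial ℝ} (hdeg : p.degree = 0)
    (hlead : 0 < p.leadingCoeff) (hnorm : (∫ x in (0:ℝ)..1, p.eval x * p.eval x) = 1) :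
    p = 1 := by
  obtain ⟨a, rfl⟩ : ∃ a, p = Polynomial.C a := ⟨_, Polynomial.eq_C_of_degree_le_zero hdeg.le⟩
  simp only [Polynomial.leadingCoeff_C] at hlead
  simp only [Polynomial.eval_C, intervalIntegral.integral_const, sub_zero, smul_eq_mul, one_mul] at hnorm
  have : a = 1 := by nlinarith
  simp [this]

/-- For `s ≥ 2`, the RKN kernel
`ā^{(s)}_{cτ} = Σ_{i<s} Σ_{j<s} (∫₀^c P_i)(∫₀¹ P_i(ξ)(∫₀^ξ P_j) dξ) P_j(τ)`
satisfies `ā^{(s)}_{1τ} = 1 − τ` for every `τ ∈ [0,1]`. -/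
theorem stmt14 (P : ℕ → Polynomial ℝ)
    (hdeg : ∀ j, (P j).degree = j)
    (hlead : ∀ j, 0 < (P j).leadingCoeff)
    (horth : ∀ i j, (∫ x in (0:ℝ)..1, (P i).eval x * (P j).eval x)
      = if i = j then 1 else 0)
    (s : ℕ) (hs : 2 ≤ s) :
    ∀ τ ∈ Set.Icc (0:ℝ) 1,
      (∑ i ∈ Finset.range s, ∑ j ∈ Finset.range s,
          (∫ x in (0:ℝ)..(1:ℝ), (P i).eval x) *
          (∫ ξ in (0:ℝ)..1, (P i).eval ξ * ∫ x in (0:ℝ)..ξ, (P j).eval x) *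
          (P j).eval τ)
        = 1 - τ := by
  intro τ _
  have hP0 : P 0 = 1 :=
    orthonormal_degree_zero_eq_one (by simpa using hdeg 0) (hlead 0) (by simpa using horth 0 0)
  have hmean : ∀ i, (∫ x in (0:ℝ)..1, (P i).eval x) = if i = 0 then 1 else 0 := fun i => by
    simpa [hP0] using horth i 0
  obtain ⟨a, b, hab⟩ : ∃ a b : ℝ, ∀ x, 1 - x = a * (P 0).eval x + b * (P 1).eval x := by
    have hu : (P 1).coeff 1 ≠ 0 := Polynomial.coeff_ne_zero_of_eq_degree (hdeg 1)
    refine ⟨1 + (P 1).coeff 0 / (P 1).coeff 1, -1 / (P 1).coeff 1, fun x => ?_⟩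
    rw [Polynomial.eq_X_add_C_of_degree_le_one (hdeg 1).le, hP0]
    simp
    field_simp
    ring
  have hcoeff : ∀ j, (∫ ξ in (0:ℝ)..1, ∫ x in (0:ℝ)..ξ, (P j).eval x)
      = a * (if 0 = j then 1 else 0) + b * (if 1 = j then 1 else 0) := fun j => by
    rw [integral_primitive_eq_integral_one_sub_mul (P j).continuous, ← horth 0 j, ← horth 1 j,
      ← intervalIntegral.integral_const_mul, ← intervalIntegral.integral_const_mul,
      ← intervalIntegral.integral_add]
    · exact integral_congr fun x _ => by simp only [hab x]; ring
    all_goals exact Continuous.intervalIntegrable (by fun_prop) _ _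
  have h0 : 0 < s := by omega
  have h1 : 1 < s := by omega
  rw [sum_eq_single_of_mem 0 (mem_range.2 h0) fun i _ hi => by simp [hmean, hi]]
  simp only [hmean, if_true, one_mul]
  simp only [hP0, Polynomial.eval_one, one_mul, hcoeff, add_mul, sum_add_distrib, mul_ite, mul_one,
    mul_zero, ite_mul, zero_mul, sum_ite_eq, mem_range, h0, h1, if_true]
  rw [hab τ, hP0, Polynomial.eval_one, mul_one]
end
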